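/- Modified Mints' theorem: let φ be a formula in which ⊥ occurs only as the conclusion of an implication, let Ξ be the set of subformulas of φ, and fix an injection (−)♭ from Ξ ∪ {⊥} into the basic sentences with p♭ = p for every atom p ∈ Ξ. Then φ is intuitionistically provable (⊢ φ) if and only if N ⊢ φ♭, where N := ⋃_{χ ∈ Ξ} M_𝔹(χ) ∪ {⊥♭ → x : x ∈ 𝔹} and 𝔹 is the set of all basic sentences. -/

import Mathlib

/-- Formulas of intuitionistic propositional logic over a countably infinite
set of atomic propositions (basic sentences), identified with `ℕ`. -/
inductive Formula : Type where
  | atom : ℕ → Formula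
  | bot  : Formula
  | and  : Formula → Formula → Formula
  | or   : Formula → Formula → Formula
  | imp  : Formula → Formula → Formula
deriving DecidableEq

/-- Derivability in intuitionistic propositional natural deduction (NJ)
from a set of hypotheses. -/
inductive NJ : Set Formula → Formula → Prop where
  | hyp   {Γ : Set Formula} {φ : Formula}     : φ ∈ Γ → NJ Γ φ
  | andI  {Γ : Set Formula} {φ ψ : Formula}   : NJ Γ φ → NJ Γ ψ → NJ Γ (φ.and ψ)
  | andE1 {Γ : Set Formula} {φ ψ : Formula}   : NJ Γ (φ.and ψ) → NJ Γ φ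
  | andE2 {Γ : Set Formula} {φ ψ : Formula}   : NJ Γ (φ.and ψ) → NJ Γ ψ
  | orI1  {Γ : Set Formula} {φ ψ : Formula}   : NJ Γ φ → NJ Γ (φ.or ψ)
  | orI2  {Γ : Set Formula} {φ ψ : Formula}   : NJ Γ ψ → NJ Γ (φ.or ψ)
  | orE   {Γ : Set Formula} {φ ψ χ : Formula} : NJ Γ (φ.or ψ) → NJ (insert φ Γ) χ → NJ (insert ψ Γ) χ → NJ Γ χ
  | impI  {Γ : Set Formula} {φ ψ : Formula}   : NJ (insert φ Γ) ψ → NJ Γ (φ.imp ψ)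
  | impE  {Γ : Set Formula} {φ ψ : Formula}   : NJ Γ (φ.imp ψ) → NJ Γ φ → NJ Γ ψ
  | botE  {Γ : Set Formula} {φ : Formula}     : NJ Γ Formula.bot → NJ Γ φ

/-- An atomic rule: either a nullary rule `ε ⇒ c`, or a general rule
`(P₁ ⇒ p₁),…,(Pₙ ⇒ pₙ) ⇒ c` with `n ≥ 1` (encoded as head premise plus
a list of further premises), where each premise is a pair of a finite set
of basic sentences and a basic sentence. -/
inductive AtomicRule : Type where
  | nullary : ℕ → AtomicRule
  | general : (Finset ℕ × ℕ) → List (Finset ℕ × ℕ) → ℕ → AtomicRule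

/-- A base is a set of atomic rules. -/
abbrev Base := Set AtomicRule

/-- Derivability in a base `B`: the smallest relation `P ⊢_B p` closed under
the three clauses. -/
inductive BaseDer (B : Base) : Set ℕ → ℕ → Prop where
  | hyp {P : Set ℕ} {p : ℕ} : p ∈ P → BaseDer B P p
  | nullary {P : Set ℕ} {c : ℕ} : AtomicRule.nullary c ∈ B → BaseDer B P c
  | general {P : Set ℕ} {hd : Finset ℕ × ℕ} {tl : List (Finset ℕ × ℕ)} {c : ℕ} :
      AtomicRule.general hd tl c ∈ B →
      (∀ pr ∈ hd :: tl, BaseDer B (P ∪ ↑pr.1) pr.2) →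
      BaseDer B P c

/-- Sandqvist's support relation `⊩_B φ`, defined by recursion on the
structure of `φ` (equivalently, on logical weight). -/
def Supp : Base → Formula → Prop
  | B, .atom p  => BaseDer B ∅ p
  | B, .bot     => ∀ p : ℕ, BaseDer B ∅ p
  | B, .and φ ψ => Supp B φ ∧ Supp B ψ
  | B, .or φ ψ  => ∀ C : Base, B ⊆ C → ∀ p : ℕ,
      (∀ D : Base, C ⊆ D → Supp D φ → BaseDer D ∅ p) →
      (∀ D : Base, C ⊆ D → Supp D ψ → BaseDer D ∅ p) →
      BaseDer C ∅ p
  | B, .imp φ ψ => ∀ C : Base, B ⊆ C → Supp C φ → Supp C ψ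

/-- Support relative to a context: `Γ ⊩_B φ`. -/
def SuppCtx (Γ : Set Formula) (B : Base) (φ : Formula) : Prop :=
  ∀ C : Base, B ⊆ C → (∀ ψ ∈ Γ, Supp C ψ) → Supp C φ

/-- `f` is a (possibly iterated) conjunction `p₁ ∧ … ∧ pₙ` (n ≥ 1) of atoms. -/
inductive AtomsConj : Formula → Prop where
  | atom (p : ℕ) : AtomsConj (.atom p)
  | and {a b : Formula} : AtomsConj a → AtomsConj b → AtomsConj (a.and b)

/-- `q*` : either a basic sentence or `⊥`. -/
def AtomOrBot (f : Formula) : Prop := (∃ p : ℕ, f = .atom p) ∨ f = .bot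

/-- An intuitionistic clause in the sense of Mints: a formula of one of the
forms `(p → q*) → r`, `p → (q ∨ r)`, or `(p₁ ∧ … ∧ pₙ) → q*`. -/
inductive IsClause : Formula → Prop where
  | impImp (p r : ℕ) {q : Formula} : AtomOrBot q →
      IsClause (((Formula.atom p).imp q).imp (.atom r))
  | impOr (p q r : ℕ) :
      IsClause ((Formula.atom p).imp ((Formula.atom q).or (.atom r)))
  | conjImp {a q : Formula} : AtomsConj a → AtomOrBot q →
      IsClause (a.imp q)

/-- A clausal system: a set of intuitionistic clauses. -/
def ClausalSystem (C : Set Formula) : Prop := ∀ f ∈ C, IsClause f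

/-- The set of subformulas of a formula. -/
def subf : Formula → Finset Formula
  | .atom p  => {.atom p}
  | .bot     => {.bot}
  | .and a b => insert (a.and b) (subf a ∪ subf b)
  | .or a b  => insert (a.or b) (subf a ∪ subf b)
  | .imp a b => insert (a.imp b) (subf a ∪ subf b)

/-- `⊥` occurs in `φ` only as the conclusion of an implication. -/
def BotGuarded : Formula → Prop
  | .atom _  => True
  | .bot     => False
  | .and a b => BotGuarded a ∧ BotGuarded b
  | .or a b  => BotGuarded a ∧ BotGuarded b
  | .imp a b => BotGuarded a ∧ (b = .bot ∨ BotGuarded b)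

/-- `fl` is a flattening for `φ`: an injection from `Ξ ∪ {⊥}` (where `Ξ` is
the set of subformulas of `φ`) into the basic sentences which fixes the
atoms of `Ξ`. -/
def FlatFor (fl : Formula → ℕ) (φ : Formula) : Prop :=
  (∀ a ∈ insert Formula.bot (subf φ), ∀ b ∈ insert Formula.bot (subf φ),
      fl a = fl b → a = b) ∧
  (∀ p : ℕ, Formula.atom p ∈ subf φ → fl (.atom p) = p)

/-- The clauses `M_X(χ)` associated with a complex subformula `χ`, relative
to a set `X` of basic sentences. -/
def MX (fl : Formula → ℕ) (X : Set ℕ) : Formula → Set Formula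
  | .and a b =>
      { (Formula.atom (fl (a.and b))).imp (.atom (fl a)),
        (Formula.atom (fl (a.and b))).imp (.atom (fl b)),
        ((Formula.atom (fl a)).and (.atom (fl b))).imp (.atom (fl (a.and b))) }
  | .or a b =>
      { (Formula.atom (fl a)).imp (.atom (fl (a.or b))),
        (Formula.atom (fl b)).imp (.atom (fl (a.or b))) } ∪
      { f | ∃ x ∈ X, f =
          (((Formula.atom (fl (a.or b))).and
              ((Formula.atom (fl a)).imp (.atom x))).and
            ((Formula.atom (fl b)).imp (.atom x))).imp (.atom x) }
  | .imp a b =>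
      { ((Formula.atom (fl a)).imp (.atom (fl b))).imp (.atom (fl (a.imp b))),
        ((Formula.atom (fl (a.imp b))).and (.atom (fl a))).imp (.atom (fl b)) }
  | _ => ∅

/-- The clause set `N := ⋃_{χ ∈ Ξ} M_𝔹(χ) ∪ {⊥♭ → x : x ∈ 𝔹}`, relative to
all basic sentences. -/
def Nset (fl : Formula → ℕ) (φ : Formula) : Set Formula :=
  (⋃ χ ∈ (↑(subf φ) : Set Formula), MX fl Set.univ χ) ∪
  { f | ∃ x : ℕ, f = (Formula.atom (fl .bot)).imp (.atom x) }

/-- Right-nested conjunction of a nonempty list of atoms (`⊥` for the empty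
list, which never occurs below). -/
def conjAtoms : List ℕ → Formula
  | []            => .bot
  | [p]           => .atom p
  | p :: q :: rest => (Formula.atom p).and (conjAtoms (q :: rest))

/-- Canonical conjunction `⋀X` of a finite set of atoms. -/
def bigConj (X : Finset ℕ) : Formula := conjAtoms (X.sort (· ≤ ·))

/-- The atoms occurring in a formula. -/
def atomsOf : Formula → Finset ℕ
  | .atom p  => {p}
  | .bot     => ∅
  | .and a b => atomsOf a ∪ atomsOf b
  | .or a b  => atomsOf a ∪ atomsOf b
  | .imp a b => atomsOf a ∪ atomsOf b

/-- `X`, the range of the flattening `fl` on `Ξ ∪ {⊥}`. -/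
def flatRange (fl : Formula → ℕ) (φ : Formula) : Finset ℕ :=
  (insert Formula.bot (subf φ)).image fl

/-- Mints' full clause set
`M_X := ⋃_{χ ∈ Ξ} M_X(χ) ∪ {(⋀X ∧ y) → ⊥♭} ∪ {⊥♭ → y} ∪ {⊥♭ → x : x ∈ X}`,
where `y` is a fresh basic sentence. -/
def MXfull (fl : Formula → ℕ) (φ : Formula) (y : ℕ) : Set Formula :=
  (⋃ χ ∈ (↑(subf φ) : Set Formula), MX fl ↑(flatRange fl φ) χ) ∪
  { ((bigConj (flatRange fl φ)).and (.atom y)).imp (.atom (fl .bot)),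
    (Formula.atom (fl .bot)).imp (.atom y) } ∪
  { f | ∃ x ∈ flatRange fl φ, f = (Formula.atom (fl .bot)).imp (.atom x) }

/-- `φ[q/⊥]`: replace every occurrence of `⊥` by the atom `q`. -/
def substBot (q : ℕ) : Formula → Formula
  | .atom p  => .atom p
  | .bot     => .atom q
  | .and a b => (substBot q a).and (substBot q b)
  | .or a b  => (substBot q a).or (substBot q b)
  | .imp a b => (substBot q a).imp (substBot q b)

/-- Right-nested conjunction of a nonempty list of formulas. -/
def conjFmls : Formula → List Formula → Formula
  | f, []        => f
  | f, g :: rest => f.and (conjFmls g rest)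

/-- The formula `⋀P → p` associated with a premise `(P ⇒ p)`, with
`⋀∅ → p` read as `p`. -/
def premFml (pr : Finset ℕ × ℕ) : Formula :=
  if pr.1 = ∅ then .atom pr.2
  else (conjAtoms (pr.1.sort (· ≤ ·))).imp (.atom pr.2)

/-- The translation `[−]` from atomic rules to formulas:
`[ε ⇒ c] = c` and
`[(P₁ ⇒ p₁),…,(Pₙ ⇒ pₙ) ⇒ c] = ((⋀P₁ → p₁) ∧ … ∧ (⋀Pₙ → pₙ)) → c`. -/
def ruleTr : AtomicRule → Formula
  | .nullary c       => .atom c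
  | .general hd tl c => (conjFmls (premFml hd) (tl.map premFml)).imp (.atom c)

/-- The translation of a base: `[𝓑] := {[r] : r ∈ 𝓑}`. -/
def baseTr (B : Base) : Set Formula := ruleTr '' B

/-- Weakening. -/
theorem NJ.mono {Γ : Set Formula} {φ : Formula} (h : NJ Γ φ) :
    ∀ {Δ : Set Formula}, Γ ⊆ Δ → NJ Δ φ := by
  induction h with
  | hyp hm => exact fun hs => .hyp (hs hm)
  | andI _ _ ih₁ ih₂ => exact fun hs => .andI (ih₁ hs) (ih₂ hs)
  | andE1 _ ih => exact fun hs => .andE1 (ih hs)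
  | andE2 _ ih => exact fun hs => .andE2 (ih hs)
  | orI1 _ ih => exact fun hs => .orI1 (ih hs)
  | orI2 _ ih => exact fun hs => .orI2 (ih hs)
  | orE _ _ _ ih ih₁ ih₂ =>
    exact fun hs => .orE (ih hs) (ih₁ (Set.insert_subset_insert hs))
      (ih₂ (Set.insert_subset_insert hs))
  | impI _ ih => exact fun hs => .impI (ih (Set.insert_subset_insert hs))
  | impE _ _ ih₁ ih₂ => exact fun hs => .impE (ih₁ hs) (ih₂ hs)
  | botE _ ih => exact fun hs => .botE (ih hs)

theorem NJ.head {Γ : Set Formula} {φ : Formula} : NJ (insert φ Γ) φ :=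
  .hyp (Set.mem_insert _ _)

namespace Formula

/-- Simultaneous substitution of formulas for atoms. -/
def subst (σ : ℕ → Formula) : Formula → Formula
  | .atom p  => σ p
  | .bot     => .bot
  | .and a b => (subst σ a).and (subst σ b)
  | .or a b  => (subst σ a).or (subst σ b)
  | .imp a b => (subst σ a).imp (subst σ b)

end Formula

/-- Derivability is closed under substitution, and substituted hypotheses may be
replaced by derivations of them. -/
theorem NJ.subst (σ : ℕ → Formula) {Γ : Set Formula} {φ : Formula} (h : NJ Γ φ) :
    ∀ {Δ : Set Formula}, (∀ γ ∈ Γ, NJ Δ (γ.subst σ)) → NJ Δ (φ.subst σ) := by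
  have lift : ∀ {Γ Δ : Set Formula} (ψ : Formula), (∀ γ ∈ Γ, NJ Δ (γ.subst σ)) →
      ∀ γ ∈ insert ψ Γ, NJ (insert (ψ.subst σ) Δ) (γ.subst σ) := by
    rintro Γ Δ ψ hs γ (rfl | hγ)
    · exact .head
    · exact (hs γ hγ).mono (Set.subset_insert _ _)
  induction h with
  | hyp hm => exact fun hs => hs _ hm
  | andI _ _ ih₁ ih₂ => exact fun hs => .andI (ih₁ hs) (ih₂ hs)
  | andE1 _ ih => exact fun hs => .andE1 (ih hs)
  | andE2 _ ih => exact fun hs => .andE2 (ih hs)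
  | orI1 _ ih => exact fun hs => .orI1 (ih hs)
  | orI2 _ ih => exact fun hs => .orI2 (ih hs)
  | orE _ _ _ ih ih₁ ih₂ =>
    exact fun hs => .orE (ih hs) (ih₁ (lift _ hs)) (ih₂ (lift _ hs))
  | impI _ ih => exact fun hs => .impI (ih (lift _ hs))
  | impE _ _ ih₁ ih₂ => exact fun hs => .impE (ih₁ hs) (ih₂ hs)
  | botE _ ih => exact fun hs => .botE (ih hs)

/-- Forcing over contexts: worlds are sets of formulas ordered by inclusion, atoms are
forced when derivable, and disjunction is read through its elimination rule restricted
to atomic conclusions. -/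
def Forces : Set Formula → Formula → Prop
  | Δ, .atom p  => NJ Δ (.atom p)
  | Δ, .bot     => ∀ p : ℕ, NJ Δ (.atom p)
  | Δ, .and a b => Forces Δ a ∧ Forces Δ b
  | Δ, .or a b  => ∀ E : Set Formula, Δ ⊆ E → ∀ p : ℕ,
      (∀ F : Set Formula, E ⊆ F → Forces F a → NJ F (.atom p)) →
      (∀ F : Set Formula, E ⊆ F → Forces F b → NJ F (.atom p)) →
      NJ E (.atom p)
  | Δ, .imp a b => ∀ E : Set Formula, Δ ⊆ E → Forces E a → Forces E b

namespace Forces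

theorem mono {φ : Formula} : ∀ {Δ E : Set Formula}, Δ ⊆ E → Forces Δ φ → Forces E φ := by
  induction φ with
  | atom p => exact fun hs h => NJ.mono h hs
  | bot => exact fun hs h p => (h p).mono hs
  | and a b iha ihb => exact fun hs h => ⟨iha hs h.1, ihb hs h.2⟩
  | or a b => exact fun hs h F hF => h F (hs.trans hF)
  | imp a b => exact fun hs h F hF => h F (hs.trans hF)

theorem of_bot {φ : Formula} : ∀ {Δ : Set Formula}, Forces Δ .bot → Forces Δ φ := by
  induction φ with
  | atom p => exact fun h => h p
  | bot => exact fun h => h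
  | and a b iha ihb => exact fun h => ⟨iha h, ihb h⟩
  | or a b => exact fun h E hE p _ _ => (h p).mono hE
  | imp a b _ ihb => exact fun h E hE _ => ihb (h.mono hE)

/-- Disjunction elimination holds for arbitrary conclusions. -/
theorem or_elim {a b φ : Formula} : ∀ {Δ : Set Formula}, Forces Δ (a.or b) →
    (∀ E : Set Formula, Δ ⊆ E → Forces E a → Forces E φ) →
    (∀ E : Set Formula, Δ ⊆ E → Forces E b → Forces E φ) → Forces Δ φ := by
  induction φ with
  | atom p => exact fun h ha hb => h _ subset_rfl p ha hb
  | bot =>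
    exact fun h ha hb p => h _ subset_rfl p (fun E hE h' => ha E hE h' p)
      (fun E hE h' => hb E hE h' p)
  | and c d ihc ihd =>
    exact fun h ha hb =>
      ⟨ihc h (fun E hE h' => (ha E hE h').1) (fun E hE h' => (hb E hE h').1),
        ihd h (fun E hE h' => (ha E hE h').2) (fun E hE h' => (hb E hE h').2)⟩
  | or c d =>
    exact fun h ha hb E hE p hc hd => h E hE p
      (fun F hF h' => ha F (hE.trans hF) h' F subset_rfl p
        (fun G hG => hc G (hF.trans hG)) (fun G hG => hd G (hF.trans hG)))
      (fun F hF h' => hb F (hE.trans hF) h' F subset_rfl p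
        (fun G hG => hc G (hF.trans hG)) (fun G hG => hd G (hF.trans hG)))
  | imp c d _ ihd =>
    exact fun h ha hb E hE hc => ihd (h.mono hE)
      (fun F hF h' => ha F (hE.trans hF) h' F subset_rfl (hc.mono hF))
      (fun F hF h' => hb F (hE.trans hF) h' F subset_rfl (hc.mono hF))

end Forces

/-- Soundness of forcing for derivability. -/
theorem NJ.forces {Γ : Set Formula} {φ : Formula} (h : NJ Γ φ) :
    ∀ {Δ : Set Formula}, (∀ γ ∈ Γ, Forces Δ γ) → Forces Δ φ := by
  have lift : ∀ {Γ Δ E : Set Formula} {ψ : Formula}, (∀ γ ∈ Γ, Forces Δ γ) → Δ ⊆ E →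
      Forces E ψ → ∀ γ ∈ insert ψ Γ, Forces E γ := by
    rintro Γ Δ E ψ hs hE hψ γ (rfl | hγ)
    · exact hψ
    · exact (hs γ hγ).mono hE
  induction h with
  | hyp hm => exact fun hs => hs _ hm
  | andI _ _ ih₁ ih₂ => exact fun hs => ⟨ih₁ hs, ih₂ hs⟩
  | andE1 _ ih => exact fun hs => (ih hs).1
  | andE2 _ ih => exact fun hs => (ih hs).2
  | orI1 _ ih => exact fun hs E hE p ha _ => ha E subset_rfl ((ih hs).mono hE)
  | orI2 _ ih => exact fun hs E hE p _ hb => hb E subset_rfl ((ih hs).mono hE)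
  | orE _ _ _ ih ih₁ ih₂ =>
    exact fun hs => (ih hs).or_elim (fun E hE h' => ih₁ (lift hs hE h'))
      (fun E hE h' => ih₂ (lift hs hE h'))
  | impI _ ih => exact fun hs E hE h' => ih (lift hs hE h')
  | impE _ _ ih₁ ih₂ => exact fun hs => ih₁ hs _ subset_rfl (ih₂ hs)
  | botE _ ih => exact fun hs => (ih hs).of_bot

theorem mem_subf_self (φ : Formula) : φ ∈ subf φ := by
  cases φ <;> simp [subf]

theorem subf_subset {χ φ : Formula} (h : χ ∈ subf φ) : subf χ ⊆ subf φ := by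
  induction φ with
  | atom p => simp_all [subf]
  | bot => simp_all [subf]
  | and a b iha ihb | or a b iha ihb | imp a b iha ihb =>
    simp only [subf, Finset.mem_insert, Finset.mem_union] at h
    rcases h with rfl | h | h
    · rfl
    · intro x hx
      simp [subf, iha h hx]
    · intro x hx
      simp [subf, ihb h hx]

theorem MX_subset_Nset (fl : Formula → ℕ) {φ χ : Formula} (h : χ ∈ subf φ) :
    MX fl Set.univ χ ⊆ Nset fl φ :=
  fun _ hf => Or.inl (Set.mem_biUnion (Finset.mem_coe.2 h) hf)

/-- Over contexts containing the clauses, forcing a subformula amounts to deriving its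
flattening. -/
theorem forces_iff_nj_flat {fl : Formula → ℕ} {φ : Formula}
    (hat : ∀ p : ℕ, Formula.atom p ∈ subf φ → fl (.atom p) = p) (χ : Formula) :
    subf χ ⊆ subf φ → ∀ {Δ : Set Formula}, Nset fl φ ⊆ Δ →
      (Forces Δ χ ↔ NJ Δ (.atom (fl χ))) := by
  induction χ with
  | atom p =>
    intro hχ Δ _
    rw [hat p (hχ (mem_subf_self _))]
    rfl
  | bot =>
    intro _ Δ hΔ
    exact ⟨fun h => h _, fun h p => .impE (.hyp (hΔ (Or.inr ⟨p, rfl⟩))) h⟩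
  | and a b iha ihb =>
    intro hχ Δ hΔ
    have hM := (MX_subset_Nset fl (hχ (mem_subf_self _))).trans hΔ
    have iha := iha ((subf_subset (by simp [subf, mem_subf_self])).trans hχ) hΔ
    have ihb := ihb ((subf_subset (by simp [subf, mem_subf_self])).trans hχ) hΔ
    constructor
    · exact fun h => .impE (.hyp (hM (by simp [MX]))) (.andI (iha.1 h.1) (ihb.1 h.2))
    · exact fun h => ⟨iha.2 (.impE (.hyp (hM (by simp [MX]))) h),
        ihb.2 (.impE (.hyp (hM (by simp [MX]))) h)⟩
  | or a b iha ihb =>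
    intro hχ Δ hΔ
    have hM := (MX_subset_Nset fl (hχ (mem_subf_self _))).trans hΔ
    have iha {E} := @iha ((subf_subset (by simp [subf, mem_subf_self])).trans hχ) E
    have ihb {E} := @ihb ((subf_subset (by simp [subf, mem_subf_self])).trans hχ) E
    constructor
    · exact fun h => h Δ subset_rfl _
        (fun E hE h' => .impE (.hyp (hE (hM (by simp [MX])))) ((iha (hΔ.trans hE)).1 h'))
        (fun E hE h' => .impE (.hyp (hE (hM (by simp [MX])))) ((ihb (hΔ.trans hE)).1 h'))
    · intro h E hE p ha hb
      have hins (ψ : Formula) : Nset fl φ ⊆ insert ψ E :=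
        (hΔ.trans hE).trans (Set.subset_insert _ _)
      exact .impE (.hyp (hE (hM (Or.inr ⟨p, trivial, rfl⟩))))
        (.andI (.andI (h.mono hE)
          (.impI (ha _ (Set.subset_insert _ _) ((iha (hins _)).2 .head))))
          (.impI (hb _ (Set.subset_insert _ _) ((ihb (hins _)).2 .head))))
  | imp a b iha ihb =>
    intro hχ Δ hΔ
    have hM := (MX_subset_Nset fl (hχ (mem_subf_self _))).trans hΔ
    have iha {E} := @iha ((subf_subset (by simp [subf, mem_subf_self])).trans hχ) E
    have ihb {E} := @ihb ((subf_subset (by simp [subf, mem_subf_self])).trans hχ) E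
    constructor
    · intro h
      have hins : Nset fl φ ⊆ insert (.atom (fl a)) Δ := hΔ.trans (Set.subset_insert _ _)
      exact .impE (.hyp (hM (by simp [MX])))
        (.impI ((ihb hins).1 (h _ (Set.subset_insert _ _) ((iha hins).2 .head))))
    · intro h E hE h'
      exact (ihb (hΔ.trans hE)).2 (.impE (.hyp (hE (hM (by simp [MX]))))
        (.andI (h.mono hE) ((iha (hΔ.trans hE)).1 h')))

/-- A substitution undoing the flattening turns every clause into a theorem. -/
theorem nj_subst_of_mem_Nset {fl : Formula → ℕ} {φ : Formula} {σ : ℕ → Formula}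
    (hσ : ∀ χ ∈ insert Formula.bot (subf φ), σ (fl χ) = χ) {γ : Formula}
    (hγ : γ ∈ Nset fl φ) : NJ ∅ (γ.subst σ) := by
  have hsub : ∀ {χ ψ : Formula}, χ ∈ subf φ → ψ ∈ subf χ → σ (fl ψ) = ψ :=
    fun hχ hψ => hσ _ (Finset.mem_insert_of_mem (subf_subset hχ hψ))
  rcases hγ with hγ | ⟨x, rfl⟩
  · obtain ⟨χ, hχ, hγ⟩ := Set.mem_iUnion₂.1 hγ
    have hχ : χ ∈ subf φ := hχ
    have hs := hsub hχ (mem_subf_self χ)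
    cases χ with
    | atom p => exact hγ.elim
    | bot => exact hγ.elim
    | and a b =>
      have ha := hsub hχ (ψ := a) (by simp [subf, mem_subf_self])
      have hb := hsub hχ (ψ := b) (by simp [subf, mem_subf_self])
      rcases hγ with rfl | rfl | rfl <;> simp only [Formula.subst, ha, hb, hs]
      · exact .impI (.andE1 .head)
      · exact .impI (.andE2 .head)
      · exact .impI .head
    | or a b =>
      have ha := hsub hχ (ψ := a) (by simp [subf, mem_subf_self])
      have hb := hsub hχ (ψ := b) (by simp [subf, mem_subf_self])
      rcases hγ with (rfl | rfl) | ⟨x, -, rfl⟩ <;> simp only [Formula.subst, ha, hb, hs]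
      · exact .impI (.orI1 .head)
      · exact .impI (.orI2 .head)
      · exact .impI (.orE (.andE1 (.andE1 .head))
          (.impE (.andE2 (.andE1 (NJ.head.mono (Set.subset_insert _ _)))) .head)
          (.impE (.andE2 (NJ.head.mono (Set.subset_insert _ _))) .head))
    | imp a b =>
      have ha := hsub hχ (ψ := a) (by simp [subf, mem_subf_self])
      have hb := hsub hχ (ψ := b) (by simp [subf, mem_subf_self])
      rcases hγ with rfl | rfl <;> simp only [Formula.subst, ha, hb, hs]
      · exact .impI .head
      · exact .impI (.impE (.andE1 .head) (.andE2 .head))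
  · simp only [Formula.subst, hσ _ (Finset.mem_insert_self _ _)]
    exact .impI (.botE .head)

/-- Modified Mints' theorem: `⊢ φ` iff `N ⊢ φ♭`, where `N` is the clause set
for `φ` over all basic sentences. -/
theorem modified_mints (φ : Formula) (hφ : BotGuarded φ)
    (fl : Formula → ℕ) (hfl : FlatFor fl φ) :
    NJ ∅ φ ↔ NJ (Nset fl φ) (.atom (fl φ)) := by
  constructor
  · intro h
    exact (forces_iff_nj_flat hfl.2 φ subset_rfl subset_rfl).1
      (h.forces fun _ hγ => hγ.elim)
  · intro h
    have : Nonempty Formula := ⟨.bot⟩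
    have hinj : Set.InjOn fl ↑(insert Formula.bot (subf φ)) :=
      fun a ha b hb => hfl.1 a ha b hb
    have hσ : ∀ χ ∈ insert Formula.bot (subf φ),
        Function.invFunOn fl ↑(insert Formula.bot (subf φ)) (fl χ) = χ :=
      fun χ hχ => hinj.leftInvOn_invFunOn hχ
    have hd := h.subst _ fun γ hγ => nj_subst_of_mem_Nset hσ hγ
    rwa [Formula.subst, hσ φ (Finset.mem_insert_of_mem (mem_subf_self φ))] at hd
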